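/- arXiv:2404.15682 — 9 statements merged into one kernel-verified Lean document; each statement's English description precedes it below -/
import Mathlib

section
/- Let (X,d) be a complete metric space and let T : X → X be a generalized orbital triangular contraction on X (with constant α ∈ [0,1)). Suppose T has no periodic points of prime period 2, i.e., there is no point x ∈ X with T(T(x)) = x and T(x) ≠ x. Then T has a unique fixed point. -/
/-- Theorem 3 (fixed point theorem for generalized orbital triangular contractions):
a generalized orbital triangular contraction on a complete metric space with no
periodic points of prime period 2 has a unique fixed point. -/
theorem stmt_0 {X : Type*} [MetricSpace X] [CompleteSpace X] [Nonempty X]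
    (T : X → X) (α : ℝ) (hα0 : 0 ≤ α) (hα1 : α < 1)
    (hT : ∀ x y : X, x ≠ y → y ≠ T x →
      dist (T x) (T (T x)) + dist (T (T x)) (T y) + dist (T y) (T x) ≤
        α * (dist x (T x) + dist (T x) y + dist y x))
    (hper : ¬ ∃ x : X, T (T x) = x ∧ T x ≠ x) :
    ∃! x : X, T x = x := by
  refine existsUnique_of_exists_of_unique ?_ ?_
  · by_contra! hfix
    have hper' : ∀ x, T (T x) ≠ x := fun x h => hper ⟨x, h, hfix x⟩
    obtain ⟨x₀⟩ := ‹Nonempty X›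
    set u : ℕ → X := fun n => T^[n] x₀ with hu
    have hsucc : ∀ n, u (n + 1) = T (u n) := fun n => Function.iterate_succ_apply' T n x₀
    set P : ℕ → ℝ := fun n =>
      dist (u n) (u (n + 1)) + dist (u (n + 1)) (u (n + 2)) + dist (u (n + 2)) (u n) with hP
    have hstep : ∀ n, P (n + 1) ≤ α * P n := fun n => by
      have h := hT (u n) (T (T (u n))) (hper' _).symm (hfix _)
      simpa only [hP, hsucc] using h
    have hgeom : ∀ n, P n ≤ P 0 * α ^ n := fun n => by
      induction n with
      | zero => simp
      | succ n ih =>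
        calc P (n + 1) ≤ α * P n := hstep n
          _ ≤ α * (P 0 * α ^ n) := by gcongr
          _ = P 0 * α ^ (n + 1) := by ring
    have hcauchy : CauchySeq u := cauchySeq_of_le_geometric α (P 0) hα1 fun n => by
      refine le_trans ?_ (hgeom n)
      have h₁ : 0 ≤ dist (u (n + 1)) (u (n + 2)) := dist_nonneg
      have h₂ : 0 ≤ dist (u (n + 2)) (u n) := dist_nonneg
      simp only [hP]
      linarith
    obtain ⟨z, hz⟩ := cauchySeq_tendsto_of_complete hcauchy
    have hz' : Filter.Tendsto (fun n => u (n + 1)) Filter.atTop (nhds z) :=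
      hz.comp (Filter.tendsto_add_atTop_nat 1)
    have hfreq : ∃ᶠ n in Filter.atTop, u n ≠ z ∧ z ≠ T (u n) := by
      refine Filter.frequently_atTop.2 fun N => ?_
      by_cases h₀ : u N = z
      · exact ⟨N + 1, by lia, by rw [hsucc, h₀]; exact hfix z,
          by rw [hsucc, h₀]; exact (hper' z).symm⟩
      by_cases h₁ : u (N + 1) = z
      · exact ⟨N + 2, by lia, by rw [hsucc, h₁]; exact hfix z,
          by rw [hsucc (N + 1), h₁]; exact (hper' z).symm⟩
      · exact ⟨N, le_rfl, h₀, fun h => h₁ (by rw [hsucc, ← h])⟩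
    have hlim : Filter.Tendsto (fun n => α * (dist (u n) (u (n + 1)) + dist (u (n + 1)) z +
        dist z (u n)) - dist (T z) (u (n + 1))) Filter.atTop
        (nhds (α * (dist z z + dist z z + dist z z) - dist (T z) z)) :=
      ((((hz.dist hz').add (hz'.dist tendsto_const_nhds)).add
        (tendsto_const_nhds.dist hz)).const_mul α).sub (tendsto_const_nhds.dist hz')
    have hnonneg := ge_of_tendsto_of_frequently hlim (b := 0) <| hfreq.mono fun n hn => by
      have h := hT (u n) z hn.1 hn.2
      have h₁ : 0 ≤ dist (T (u n)) (T (T (u n))) := dist_nonneg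
      have h₂ : 0 ≤ dist (T (T (u n))) (T z) := dist_nonneg
      rw [hsucc]
      linarith
    have hpos : 0 < dist (T z) z := dist_pos.2 (hfix z)
    simp only [dist_self] at hnonneg
    linarith
  · intro x y hx hy
    by_contra hxy
    have h := hT x y hxy (by rw [hx]; exact Ne.symm hxy)
    simp only [hx, hy, dist_self, dist_comm y x] at h
    nlinarith [dist_pos.2 hxy]
end

section
/- Let (X,d) be a complete metric space and let T : X → X be a generalized orbital triangular Kannan contraction on X (with constant β ∈ [0,2/3)). Suppose T has no periodic points of prime period 2, i.e., there is no point x ∈ X with T(T(x)) = x and T(x) ≠ x. Then T has a fixed point. -/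
open Filter Topology

/-- A nonnegative sequence with `a (n + 2) ≤ c * (a n + a (n + 1))`, `c < 1 / 2`, is summable. -/
theorem summable_of_le_mul_add {a : ℕ → ℝ} {c : ℝ} (ha : ∀ n, 0 ≤ a n) (hc0 : 0 ≤ c)
    (hc : c < 1 / 2) (h : ∀ n, a (n + 2) ≤ c * (a n + a (n + 1))) : Summable a := by
  have bound (n : ℕ) : ∑ i ∈ Finset.range (n + 2), a i ≤
      a 0 + a 1 + c * (∑ i ∈ Finset.range n, a i + ∑ i ∈ Finset.range (n + 1), a i) := by
    induction n with
    | zero => simpa [Finset.sum_range_succ] using mul_nonneg hc0 (ha 0)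
    | succ n ih =>
      rw [Finset.sum_range_succ _ (n + 2), Finset.sum_range_succ _ (n + 1)]
      rw [Finset.sum_range_succ _ (n + 1)] at ih
      have hs := Finset.sum_range_succ a n
      have := h n
      linear_combination ih + this - c * hs
  refine summable_of_sum_range_le (c := (a 0 + a 1) / (1 - 2 * c)) ha fun n => ?_
  rw [le_div_iff₀ (by linarith)]
  have h1 := Finset.sum_range_succ a n
  have h2 := Finset.sum_range_succ a (n + 1)
  have hb := bound n
  have := ha n
  have := ha (n + 1)
  have hmul : c * ∑ i ∈ Finset.range (n + 1), a i ≤ c * ∑ i ∈ Finset.range (n + 2), a i :=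
    mul_le_mul_of_nonneg_left (by linarith) hc0
  have hmul' : c * ∑ i ∈ Finset.range n, a i ≤ c * ∑ i ∈ Finset.range (n + 2), a i :=
    mul_le_mul_of_nonneg_left (by linarith) hc0
  have hle : ∑ i ∈ Finset.range n, a i ≤ ∑ i ∈ Finset.range (n + 2), a i := by linarith
  have := mul_le_mul_of_nonneg_right hle (show 0 ≤ 1 - 2 * c by linarith)
  linarith

/-- Theorem (fixed point theorem for generalized orbital triangular Kannan
contractions): such a contraction on a complete metric space with no periodic
points of prime period 2 has a fixed point. -/
theorem stmt_1 {X : Type*} [MetricSpace X] [CompleteSpace X] [Nonempty X]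
    (T : X → X) (β : ℝ) (hβ0 : 0 ≤ β) (hβ1 : β < 2/3)
    (hT : ∀ x y : X, x ≠ y → y ≠ T x → x ≠ T x →
      dist (T x) (T (T x)) + dist (T (T x)) (T y) + dist (T y) (T x) ≤
        β * (dist x (T x) + dist y (T y) + dist (T x) (T (T x))))
    (hper : ¬ ∃ x : X, T (T x) = x ∧ T x ≠ x) :
    ∃ x : X, T x = x := by
  by_contra! hfix
  have hper' (x : X) : T (T x) ≠ x := fun hx => hper ⟨x, hx, hfix x⟩
  obtain ⟨x₀⟩ := ‹Nonempty X›
  set u : ℕ → X := fun n => T^[n] x₀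
  have hu (n : ℕ) : u (n + 1) = T (u n) := Function.iterate_succ_apply' T n x₀
  have hsum : Summable fun n => dist (u n) (u (n + 1)) := by
    refine summable_of_le_mul_add (c := β / (2 - β)) (fun _ => dist_nonneg)
      (div_nonneg hβ0 (by linarith)) (by rw [div_lt_iff₀ (by linarith)]; linarith) fun n => ?_
    have h := hT (u n) (T (T (u n))) (hper' _).symm (hfix _) (hfix _).symm
    simp only [← hu] at h
    have htri := dist_triangle_right (u (n + 2)) (u (n + 3)) (u (n + 1))
    rw [dist_comm (u (n + 2)) (u (n + 1))] at htri
    rw [div_mul_eq_mul_div, le_div_iff₀ (by linarith)]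
    change dist (u (n + 2)) (u (n + 3)) * (2 - β) ≤
      β * (dist (u n) (u (n + 1)) + dist (u (n + 1)) (u (n + 2)))
    linarith
  obtain ⟨z, hz⟩ := cauchySeq_tendsto_of_complete (cauchySeq_of_summable_dist hsum)
  have hd := hsum.tendsto_atTop_zero
  have hpos : 0 < dist z (T z) := dist_pos.2 (hfix z).symm
  have hne : ∀ᶠ n in atTop, u n ≠ z := by
    filter_upwards [hd.eventually_lt_const hpos] with n hn h
    rw [hu, h] at hn
    exact hn.false
  have hz1 := (tendsto_add_atTop_iff_nat 1).2 hz
  have hz2 := (tendsto_add_atTop_iff_nat 2).2 hz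
  have hd1 := (tendsto_add_atTop_iff_nat 1).2 hd
  have hlim := le_of_tendsto_of_tendsto
    ((hd1.add (hz2.dist tendsto_const_nhds)).add ((tendsto_const_nhds (x := T z)).dist hz1))
    (((hd.add (tendsto_const_nhds (x := dist z (T z)))).add hd1).const_mul β) (by
      filter_upwards [hne, (tendsto_add_atTop_nat 1).eventually hne] with n h0 h1
      have h := hT (u n) z h0 (by rw [← hu]; exact h1.symm) (hfix _).symm
      simp only [← hu] at h
      exact h)
  rw [dist_comm (T z) z] at hlim
  nlinarith
end

section
/- Let (X,d) be a complete metric space and let T : X → X be a generalized orbital triangular Chatterjea contraction on X (with constant γ ∈ [0,1/2)). Suppose T has no periodic points of prime period 2, i.e., there is no point x ∈ X with T(T(x)) = x and T(x) ≠ x. Then T has a unique fixed point. -/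
open Filter Topology

/-- Perimeter of the triangle spanned by the first three points of an orbit. -/
noncomputable def orbitPerimeter {X : Type*} [MetricSpace X] (T : X → X) (x : X) : ℝ :=
  dist x (T x) + dist (T x) (T (T x)) + dist x (T (T x))

theorem orbitPerimeter_map_le {X : Type*} [MetricSpace X] {T : X → X} {γ : ℝ}
    (hγ0 : 0 ≤ γ) (hγ1 : γ < 1) {x : X}
    (h : dist (T x) (T (T x)) + dist (T (T x)) (T (T (T x))) + dist (T (T (T x))) (T x) ≤
        γ * (dist x (T (T (T x))) + dist (T (T x)) (T x) + dist x (T (T x)) +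
          dist (T (T x)) (T (T x)) + dist (T x) (T (T (T x))))) :
    orbitPerimeter T (T x) ≤ γ / (1 - γ) * orbitPerimeter T x := by
  have hsum : dist x (T (T (T x))) + dist (T (T x)) (T x) + dist x (T (T x)) +
      dist (T (T x)) (T (T x)) + dist (T x) (T (T (T x))) ≤
      orbitPerimeter T x + orbitPerimeter T (T x) := by
    unfold orbitPerimeter
    have h1 := dist_triangle x (T x) (T (T (T x)))
    have h2 := dist_triangle (T x) (T (T x)) (T (T (T x)))
    rw [dist_self, dist_comm (T (T x)) (T x)]
    linarith
  have hle : orbitPerimeter T (T x) ≤ γ * (orbitPerimeter T x + orbitPerimeter T (T x)) := by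
    refine le_trans ?_ (h.trans (mul_le_mul_of_nonneg_left hsum hγ0))
    rw [orbitPerimeter, dist_comm (T (T (T x))) (T x)]
  rw [div_mul_eq_mul_div, le_div_iff₀ (by linarith)]
  linarith

/-- Theorem (fixed point theorem for generalized orbital triangular Chatterjea
contractions): such a contraction on a complete metric space with no periodic
points of prime period 2 has a unique fixed point. -/
theorem stmt_2 {X : Type*} [MetricSpace X] [CompleteSpace X] [Nonempty X]
    (T : X → X) (γ : ℝ) (hγ0 : 0 ≤ γ) (hγ1 : γ < 1/2)
    (hT : ∀ x y : X, x ≠ y → y ≠ T x →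
      dist (T x) (T (T x)) + dist (T (T x)) (T y) + dist (T y) (T x) ≤
        γ * (dist x (T y) + dist y (T x) + dist x (T (T x)) +
          dist y (T (T x)) + dist (T x) (T y)))
    (hper : ¬ ∃ x : X, T (T x) = x ∧ T x ≠ x) :
    ∃! x : X, T x = x := by
  have hex : ∃ x : X, T x = x := by
    by_contra! hfix
    push Not at hper
    have h2 (x : X) : x ≠ T (T x) := fun h => hfix x (hper x h.symm)
    have hk0 : 0 ≤ γ / (1 - γ) := div_nonneg hγ0 (by linarith)
    have hk1 : γ / (1 - γ) < 1 := (div_lt_one (by linarith)).2 (by linarith)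
    obtain ⟨x₀⟩ := ‹Nonempty X›
    let u : ℕ → X := fun n => T^[n] x₀
    have hu (n : ℕ) : u (n + 1) = T (u n) := Function.iterate_succ_apply' T n x₀
    have hgeom (n : ℕ) :
        orbitPerimeter T (u n) ≤ orbitPerimeter T x₀ * (γ / (1 - γ)) ^ n := by
      induction n with
      | zero => simp [u]
      | succ n ih =>
        rw [hu]
        have hstep := orbitPerimeter_map_le hγ0 (by linarith)
          (hT (u n) (T (T (u n))) (h2 _) (hfix _))
        calc _ ≤ _ := hstep
          _ ≤ _ := mul_le_mul_of_nonneg_left ih hk0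
          _ = _ := by ring
    have hdist (n : ℕ) :
        dist (u n) (u (n + 1)) ≤ orbitPerimeter T x₀ * (γ / (1 - γ)) ^ n := by
      refine le_trans ?_ (hgeom n)
      rw [hu, orbitPerimeter, add_assoc]
      exact le_add_of_nonneg_right (by positivity)
    obtain ⟨z, hz⟩ := cauchySeq_tendsto_of_complete
      (cauchySeq_of_le_geometric _ _ hk1 hdist)
    have hz1 : Tendsto (fun n => u (n + 1)) atTop (𝓝 z) := (tendsto_add_atTop_iff_nat 1).2 hz
    have hz2 : Tendsto (fun n => u (n + 2)) atTop (𝓝 z) := (tendsto_add_atTop_iff_nat 2).2 hz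
    have hpos : 0 < dist z (T z) := dist_pos.2 (hfix z).symm
    have hne : ∀ᶠ n in atTop, u n ≠ z := by
      have hlim := hz.dist hz1
      rw [dist_self] at hlim
      filter_upwards [hlim.eventually_lt_const hpos] with n hn heq
      rw [hu, heq] at hn
      exact lt_irrefl _ hn
    have hne1 : ∀ᶠ n in atTop, u (n + 1) ≠ z := (tendsto_add_atTop_nat 1).eventually hne
    have c (w : X) : Tendsto (fun _ : ℕ => w) atTop (𝓝 w) := tendsto_const_nhds
    have hlim := le_of_tendsto_of_tendsto
      (((hz1.dist hz2).add (hz2.dist (c (T z)))).add ((c (T z)).dist hz1))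
      ((((((hz.dist (c (T z))).add ((c z).dist hz1)).add (hz.dist hz2)).add
        ((c z).dist hz2)).add (hz1.dist (c (T z)))).const_mul γ)
      (by
        filter_upwards [hne, hne1] with n hn hn1
        have hle := hT (u n) z hn (by rw [← hu]; exact hn1.symm)
        simpa only [← hu] using hle)
    rw [dist_self, dist_comm (T z) z] at hlim
    nlinarith
  obtain ⟨x, hx⟩ := hex
  refine ⟨x, hx, fun y hy => ?_⟩
  by_contra hxy
  have h := hT x y (Ne.symm hxy) (by rwa [hx])
  simp only [hx, hy, dist_self, dist_comm y x] at h
  have hpos : 0 < dist x y := dist_pos.2 (Ne.symm hxy)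
  nlinarith
end

section
/- Let (X,d) be a metric space and let T : X → X be a Kannan contraction with constant C ∈ [0,1/3), i.e., d(Tx,Ty) ≤ C·[d(x,Tx) + d(y,Ty)] for all x, y ∈ X. Then T is a generalized orbital triangular Kannan contraction with constant β = 2C ∈ [0,2/3): for all x, y ∈ X such that x, y, Tx are pairwise distinct, one has d(Tx,T²x) + d(T²x,Ty) + d(Ty,Tx) ≤ 2C·[d(x,Tx) + d(y,Ty) + d(Tx,T²x)]. -/
/-- Remark: every Kannan contraction with constant C < 1/3 is a generalized
orbital triangular Kannan contraction with constant 2C. -/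
theorem stmt_5 {X : Type*} [MetricSpace X]
    (T : X → X) (C : ℝ) (hC0 : 0 ≤ C) (hC1 : C < 1/3)
    (hT : ∀ x y : X, dist (T x) (T y) ≤ C * (dist x (T x) + dist y (T y))) :
    ∀ x y : X, x ≠ y → y ≠ T x → x ≠ T x →
      dist (T x) (T (T x)) + dist (T (T x)) (T y) + dist (T y) (T x) ≤
        2 * C * (dist x (T x) + dist y (T y) + dist (T x) (T (T x))) := by
  intro x y _ _ _
  linarith [hT x (T x), hT (T x) y, hT y x]
end

section
/- Let X = [0,1] ⊆ ℝ with the usual metric d(x,y) = |x−y|, and let T : X → X be defined by Tx = 0 for x ∈ [0,1) and T(1) = 1/4. Then T is a generalized orbital triangular contraction with constant α = 2/3: for all x, y ∈ X with x ≠ y and y ≠ Tx, one has d(Tx,T²x) + d(T²x,Ty) + d(Ty,Tx) ≤ (2/3)·[d(x,Tx) + d(Tx,y) + d(y,x)]. -/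
/-- The map T on [0,1] with Tx = 0 for x ∈ [0,1) and T1 = 1/4. -/
noncomputable def T7 : Set.Icc (0:ℝ) 1 → Set.Icc (0:ℝ) 1 :=
  fun x => if (x : ℝ) < 1 then ⟨0, by norm_num⟩ else ⟨1/4, by norm_num⟩

theorem T7_coe_of_lt {x : Set.Icc (0:ℝ) 1} (hx : (x : ℝ) < 1) : (T7 x : ℝ) = 0 := by
  simp [T7, hx]

theorem T7_coe_of_eq_one {x : Set.Icc (0:ℝ) 1} (hx : (x : ℝ) = 1) : (T7 x : ℝ) = 1 / 4 := by
  simp [T7, hx]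

theorem T7_T7_coe (x : Set.Icc (0:ℝ) 1) : (T7 (T7 x) : ℝ) = 0 := by
  apply T7_coe_of_lt
  rcases x.2.2.lt_or_eq with hx | hx
  · norm_num [T7_coe_of_lt hx]
  · norm_num [T7_coe_of_eq_one hx]

/-- Remark: T7 is a generalized orbital triangular contraction with α = 2/3. -/
theorem stmt_7 :
    ∀ x y : Set.Icc (0:ℝ) 1, x ≠ y → y ≠ T7 x →
      dist (T7 x) (T7 (T7 x)) + dist (T7 (T7 x)) (T7 y) + dist (T7 y) (T7 x) ≤
        (2/3) * (dist x (T7 x) + dist (T7 x) y + dist y x) := by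
  intro x y hxy _
  simp only [Subtype.dist_eq, Real.dist_eq, T7_T7_coe]
  rcases x.2.2.lt_or_eq with hx | hx <;> rcases y.2.2.lt_or_eq with hy | hy
  · rw [T7_coe_of_lt hx, T7_coe_of_lt hy]
    simp only [sub_self, abs_zero, add_zero]
    positivity
  · rw [T7_coe_of_lt hx, T7_coe_of_eq_one hy, hy]
    norm_num
    linarith [abs_nonneg (x : ℝ), abs_nonneg (1 - (x : ℝ))]
  · rw [T7_coe_of_eq_one hx, T7_coe_of_lt hy, hx]
    norm_num
    linarith [abs_nonneg (1 / 4 - (y : ℝ)), abs_nonneg ((y : ℝ) - 1)]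
  · exact absurd (Subtype.ext (hx.trans hy.symm)) hxy
end

section
/- Let (X,d) be a metric space, let T : X → X be a generalized orbital triangular Kannan contraction with constant β ∈ [0,2/3), and let x ∈ X be such that x, Tx, T²x are pairwise distinct. Then d(Tx,T²x) ≤ (β/(2−2β))·d(x,Tx). In particular, since β < 2/3, the factor λ = β/(2−2β) satisfies λ < 1. -/
/-- For a generalized orbital triangular Kannan contraction and x with
x, Tx, T²x pairwise distinct, d(Tx,T²x) ≤ (β/(2−2β))·d(x,Tx), and the factor
β/(2−2β) is < 1. -/
theorem stmt_10 {X : Type*} [MetricSpace X]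
    (T : X → X) (β : ℝ) (hβ0 : 0 ≤ β) (hβ1 : β < 2/3)
    (hT : ∀ x y : X, x ≠ y → y ≠ T x → x ≠ T x →
      dist (T x) (T (T x)) + dist (T (T x)) (T y) + dist (T y) (T x) ≤
        β * (dist x (T x) + dist y (T y) + dist (T x) (T (T x))))
    (x : X) (h1 : x ≠ T x) (h2 : T x ≠ T (T x)) (h3 : x ≠ T (T x)) :
    dist (T x) (T (T x)) ≤ (β / (2 - 2 * β)) * dist x (T x) ∧
      β / (2 - 2 * β) < 1 := by
  have hpos : 0 < 2 - 2 * β := by linarith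
  have hK := hT x (T (T x)) h3 h2.symm h1
  have htri := dist_triangle (T x) (T (T (T x))) (T (T x))
  rw [dist_comm (T x) (T (T (T x))), dist_comm (T (T (T x))) (T (T x))] at htri
  refine ⟨?_, by rw [div_lt_one hpos]; linarith⟩
  rw [div_mul_eq_mul_div, le_div_iff₀ hpos]
  have hscaled := mul_le_mul_of_nonneg_left htri (by linarith : 0 ≤ 1 - β)
  have hdrop := mul_nonneg hβ0 (dist_nonneg (x := T (T (T x))) (y := T x))
  linarith
end

section
/- Let (X,d) be a metric space, let T : X → X be a generalized orbital triangular Chatterjea contraction with constant γ ∈ [0,1/2), and let x ∈ X satisfy x ≠ T²x and T²x ≠ Tx. Then d(Tx,T²x) + d(T²x,T³x) + d(T³x,Tx) ≤ (γ/(1−γ))·[d(x,Tx) + d(Tx,T²x) + d(T²x,x)], i.e., the perimeter of the triple (Tx, T²x, T³x) is at most γ/(1−γ) times the perimeter of the triple (x, Tx, T²x), and γ/(1−γ) < 1. -/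
/-- For a generalized orbital triangular Chatterjea contraction and x with
x ≠ T²x and T²x ≠ Tx, the perimeter of (Tx, T²x, T³x) is at most γ/(1−γ) times
the perimeter of (x, Tx, T²x), and γ/(1−γ) < 1. -/
theorem stmt_11 {X : Type*} [MetricSpace X]
    (T : X → X) (γ : ℝ) (hγ0 : 0 ≤ γ) (hγ1 : γ < 1/2)
    (hT : ∀ x y : X, x ≠ y → y ≠ T x →
      dist (T x) (T (T x)) + dist (T (T x)) (T y) + dist (T y) (T x) ≤
        γ * (dist x (T y) + dist y (T x) + dist x (T (T x)) +
          dist y (T (T x)) + dist (T x) (T y)))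
    (x : X) (h1 : x ≠ T (T x)) (h2 : T (T x) ≠ T x) :
    (dist (T x) (T (T x)) + dist (T (T x)) (T (T (T x))) +
        dist (T (T (T x))) (T x) ≤
      (γ / (1 - γ)) * (dist x (T x) + dist (T x) (T (T x)) + dist (T (T x)) x))
      ∧ γ / (1 - γ) < 1 := by
  have hpos : 0 < 1 - γ := by linarith
  refine ⟨?_, by rw [div_lt_one hpos]; linarith⟩
  have h := hT x (T (T x)) h1 h2
  have htri : dist x (T (T (T x))) ≤
      dist x (T x) + dist (T x) (T (T x)) + dist (T (T x)) (T (T (T x))) :=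
    dist_triangle4 _ _ _ _
  have hmul := mul_le_mul_of_nonneg_left htri hγ0
  rw [dist_self, dist_comm (T (T x)) (T x), dist_comm (T x) (T (T (T x)))] at h
  rw [div_mul_eq_mul_div, le_div_iff₀ hpos, dist_comm (T (T x)) x]
  linarith
end

section
/- Let (X,d) be a metric space, let T : X → X be a generalized orbital triangular contraction with constant α ∈ [0,1), and suppose T has no periodic points of prime period 2 (no x with T²x = x and Tx ≠ x). Fix x₀ ∈ X and define the Picard iterates xₙ₊₁ = T xₙ. If no iterate xₙ is a fixed point of T (i.e., T xₙ ≠ xₙ for all n ≥ 0), then for all n ≥ 1 and all m ∈ ℕ, d(xₙ, xₙ₊ₘ) ≤ (α^{n−1}/(1−α))·p₀, where p₀ = d(x₀,x₁) + d(x₁,x₂) + d(x₂,x₀); in particular the sequence (xₙ) is a Cauchy sequence. -/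
/-- If consecutive distances decay geometrically, the distance between two terms is bounded by the
corresponding geometric tail. -/
lemma dist_le_geometric_tail {X : Type*} [PseudoMetricSpace X] {u : ℕ → X} {r C : ℝ}
    (hr0 : 0 ≤ r) (hr1 : r < 1) (hC : 0 ≤ C) (hu : ∀ n, dist (u n) (u (n + 1)) ≤ C * r ^ n)
    (n m : ℕ) : dist (u n) (u (n + m)) ≤ r ^ n / (1 - r) * C := by
  have hr : 0 < 1 - r := sub_pos.2 hr1
  have key : (1 - r) * dist (u n) (u (n + m)) ≤ C * (r ^ n - r ^ (n + m)) := by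
    induction m with
    | zero => simp
    | succ m ih =>
      have hstep := mul_le_mul_of_nonneg_left
        ((dist_triangle (u n) (u (n + m)) (u (n + m + 1))).trans
          (add_le_add_right (hu (n + m)) _)) hr.le
      rw [← add_assoc, pow_succ]
      linarith
  rw [div_mul_eq_mul_div, le_div_iff₀ hr]
  have : 0 ≤ C * r ^ (n + m) := by positivity
  linarith

/-- For a generalized orbital triangular contraction with no periodic points of
prime period 2, if no Picard iterate is a fixed point, then
d(xₙ, xₙ₊ₘ) ≤ (α^(n−1)/(1−α))·p₀ for n ≥ 1, and the Picard iterates form a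
Cauchy sequence. -/
theorem stmt_12 {X : Type*} [MetricSpace X]
    (T : X → X) (α : ℝ) (hα0 : 0 ≤ α) (hα1 : α < 1)
    (hT : ∀ x y : X, x ≠ y → y ≠ T x →
      dist (T x) (T (T x)) + dist (T (T x)) (T y) + dist (T y) (T x) ≤
        α * (dist x (T x) + dist (T x) y + dist y x))
    (hper : ¬ ∃ x : X, T (T x) = x ∧ T x ≠ x)
    (x₀ : X) (hfix : ∀ n : ℕ, T (T^[n] x₀) ≠ T^[n] x₀) :
    (∀ n : ℕ, 1 ≤ n → ∀ m : ℕ,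
      dist (T^[n] x₀) (T^[n + m] x₀) ≤
        (α ^ (n - 1) / (1 - α)) *
          (dist x₀ (T x₀) + dist (T x₀) (T (T x₀)) + dist (T (T x₀)) x₀)) ∧
      CauchySeq (fun n : ℕ => T^[n] x₀) := by
  set p₀ := dist x₀ (T x₀) + dist (T x₀) (T (T x₀)) + dist (T (T x₀)) x₀ with hp₀
  have hp₀_nonneg : 0 ≤ p₀ := by positivity
  have hperimeter : ∀ n : ℕ,
      dist (T^[n] x₀) (T (T^[n] x₀)) + dist (T (T^[n] x₀)) (T (T (T^[n] x₀))) +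
        dist (T (T (T^[n] x₀))) (T^[n] x₀) ≤ p₀ * α ^ n := by
    intro n
    induction n with
    | zero => simp [hp₀]
    | succ n ih =>
      have hne : T^[n] x₀ ≠ T (T (T^[n] x₀)) := fun h => hper ⟨_, h.symm, hfix n⟩
      have hne' : T (T (T^[n] x₀)) ≠ T (T^[n] x₀) := by
        simpa only [Function.iterate_succ_apply'] using hfix (n + 1)
      simp only [Function.iterate_succ_apply']
      calc _ ≤ _ := hT _ _ hne hne'
        _ ≤ α * (p₀ * α ^ n) := mul_le_mul_of_nonneg_left ih hα0
        _ = p₀ * α ^ (n + 1) := by ring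
  have hdist : ∀ n : ℕ, dist (T^[n] x₀) (T^[n + 1] x₀) ≤ p₀ * α ^ n := by
    intro n
    rw [Function.iterate_succ_apply']
    refine le_trans ?_ (hperimeter n)
    rw [add_assoc]
    exact le_add_of_nonneg_right (by positivity)
  refine ⟨fun n _ m => ?_, cauchySeq_of_le_geometric α p₀ hα1 hdist⟩
  have hpow : α ^ n ≤ α ^ (n - 1) := pow_le_pow_of_le_one hα0 hα1.le (Nat.sub_le n 1)
  have hα : 0 < 1 - α := sub_pos.2 hα1
  calc dist (T^[n] x₀) (T^[n + m] x₀) ≤ α ^ n / (1 - α) * p₀ :=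
        dist_le_geometric_tail (u := fun k => T^[k] x₀) hα0 hα1 hp₀_nonneg hdist n m
    _ ≤ α ^ (n - 1) / (1 - α) * p₀ := by gcongr
end

section
/- Let (X,d) be a metric space, let T : X → X be a generalized orbital triangular Kannan contraction with constant β ∈ [0,2/3), and suppose T has no periodic points of prime period 2 (no x with T²x = x and Tx ≠ x). Fix x₀ ∈ X and define the Picard iterates xₙ₊₁ = T xₙ. If no iterate xₙ is a fixed point of T, then with λ = β/(2−2β) < 1 and d₀ = d(x₀,x₁), for all n ≥ 1 and all m ∈ ℕ one has d(xₙ, xₙ₊ₘ) ≤ (λ^{n−1}/(1−λ))·d₀; in particular the sequence (xₙ) is a Cauchy sequence. -/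
/-- One Picard step of a generalized orbital triangular Kannan contraction shrinks the
displacement `dist x (T x)` by the factor `β / (2 - 2 * β)`. -/
theorem dist_map_le_of_orbital_triangular_kannan {X : Type*} [MetricSpace X]
    {T : X → X} {β : ℝ} (hβ0 : 0 ≤ β) (hβ1 : β < 2 / 3)
    (hT : ∀ x y : X, x ≠ y → y ≠ T x → x ≠ T x →
      dist (T x) (T (T x)) + dist (T (T x)) (T y) + dist (T y) (T x) ≤
        β * (dist x (T x) + dist y (T y) + dist (T x) (T (T x))))
    {x : X} (h₀ : T x ≠ x) (h₁ : T (T x) ≠ T x) (h₂ : T (T x) ≠ x) :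
    dist (T x) (T (T x)) ≤ β / (2 - 2 * β) * dist x (T x) := by
  have key := hT x (T (T x)) h₂.symm h₁ h₀.symm
  have tri₁ := dist_triangle_right (T x) (T (T x)) (T (T (T x)))
  have tri₂ := dist_triangle_left (T (T x)) (T (T (T x))) (T x)
  rw [dist_comm (T (T (T x))) (T x)] at key
  rw [div_mul_eq_mul_div, le_div_iff₀ (by linarith)]
  rcases le_total (dist (T (T x)) (T (T (T x)))) (dist (T x) (T (T x))) with h | h
  · nlinarith [mul_le_mul_of_nonneg_left h hβ0]
  · nlinarith [mul_le_mul_of_nonneg_left h hβ0]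

/-- Partial geometric sums bound the distances in a sequence whose consecutive distances decay
geometrically. -/
theorem dist_add_le_of_dist_succ_le_geometric {X : Type*} [PseudoMetricSpace X]
    {u : ℕ → X} {r C : ℝ} (hr : r < 1) (hu : ∀ n, dist (u n) (u (n + 1)) ≤ C * r ^ n)
    (n m : ℕ) : dist (u n) (u (n + m)) ≤ (r ^ n - r ^ (n + m)) / (1 - r) * C := by
  have hr' : 1 - r ≠ 0 := by linarith
  induction m with
  | zero => simp
  | succ m ih =>
    calc dist (u n) (u (n + (m + 1)))
        ≤ dist (u n) (u (n + m)) + dist (u (n + m)) (u (n + m + 1)) := dist_triangle _ _ _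
      _ ≤ (r ^ n - r ^ (n + m)) / (1 - r) * C + C * r ^ (n + m) := add_le_add ih (hu _)
      _ = (r ^ n - r ^ (n + (m + 1))) / (1 - r) * C := by
        field_simp
        ring


/-- For a generalized orbital triangular Kannan contraction with no periodic
points of prime period 2, if no Picard iterate is a fixed point, then with
λ = β/(2−2β) < 1 one has d(xₙ, xₙ₊ₘ) ≤ (λ^(n−1)/(1−λ))·d(x₀,x₁) for n ≥ 1,
and the Picard iterates form a Cauchy sequence. -/
theorem stmt_15 {X : Type*} [MetricSpace X]
    (T : X → X) (β : ℝ) (hβ0 : 0 ≤ β) (hβ1 : β < 2/3)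
    (hT : ∀ x y : X, x ≠ y → y ≠ T x → x ≠ T x →
      dist (T x) (T (T x)) + dist (T (T x)) (T y) + dist (T y) (T x) ≤
        β * (dist x (T x) + dist y (T y) + dist (T x) (T (T x))))
    (hper : ¬ ∃ x : X, T (T x) = x ∧ T x ≠ x)
    (x₀ : X) (hfix : ∀ n : ℕ, T (T^[n] x₀) ≠ T^[n] x₀) :
    (β / (2 - 2 * β) < 1) ∧
    (∀ n : ℕ, 1 ≤ n → ∀ m : ℕ,
      dist (T^[n] x₀) (T^[n + m] x₀) ≤
        ((β / (2 - 2 * β)) ^ (n - 1) / (1 - β / (2 - 2 * β))) *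
          dist x₀ (T x₀)) ∧
      CauchySeq (fun n : ℕ => T^[n] x₀) := by
  have hlt : β / (2 - 2 * β) < 1 := by
    rw [div_lt_one (by linarith)]
    linarith
  have hnonneg : 0 ≤ β / (2 - 2 * β) := div_nonneg hβ0 (by linarith)
  have hstep : ∀ n : ℕ, dist (T^[n] x₀) (T^[n + 1] x₀) ≤
      dist x₀ (T x₀) * (β / (2 - 2 * β)) ^ n := by
    intro n
    induction n with
    | zero => simp
    | succ n ih =>
      have h₁ := hfix (n + 1)
      simp only [Function.iterate_succ_apply'] at ih h₁ ⊢
      calc _ ≤ β / (2 - 2 * β) * dist (T^[n] x₀) (T (T^[n] x₀)) :=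
            dist_map_le_of_orbital_triangular_kannan hβ0 hβ1 hT (hfix n) h₁
              fun h => hper ⟨_, h, hfix n⟩
        _ ≤ β / (2 - 2 * β) * (dist x₀ (T x₀) * (β / (2 - 2 * β)) ^ n) := by gcongr
        _ = dist x₀ (T x₀) * (β / (2 - 2 * β)) ^ (n + 1) := by ring
  refine ⟨hlt, fun n _ m => ?_, cauchySeq_of_le_geometric _ _ hlt hstep⟩
  refine (dist_add_le_of_dist_succ_le_geometric hlt hstep n m).trans ?_
  have hpos : 0 ≤ 1 - β / (2 - 2 * β) := by linarith
  gcongr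
  exact (sub_le_self _ (pow_nonneg hnonneg _)).trans
    (pow_le_pow_of_le_one hnonneg hlt.le (Nat.sub_le n 1))
end
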